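/- Let 0 < ε ≤ 1/6 and z ∈ [1/3, 2/3 − ε]. Define g_z : [0,1] → ℝ by g_z(x) = ε for x < z, g_z(x) = ε − (x − z) for z ≤ x ≤ z + ε, and g_z(x) = 0 for x > z + ε. Then for every monotone (non-decreasing) function h : [0,1] → ℝ, ∫₀¹ |g_z(x) − h(x)| dx ≥ ε/3; in particular d₁(g_z) ≥ ε/3. -/

import Mathlib

open MeasureTheory

/-- **The "step" construction on the line is far from monotone.** For `0 < ε ≤ 1/6` and
`z ∈ [1/3, 2/3 − ε]`, the function `g_z` (equal to `ε` before `z`, decreasing with slope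
`−1` on `[z, z+ε]`, and `0` afterwards) satisfies `∫₀¹ |g_z − h| ≥ ε/3` for every
monotone `h : [0,1] → ℝ`; in particular `d₁(g_z) ≥ ε/3`. -/
theorem step_function_far_from_monotone (ε z : ℝ) (hε : 0 < ε) (hε' : ε ≤ 1 / 6)
    (hz₁ : 1 / 3 ≤ z) (hz₂ : z ≤ 2 / 3 - ε) (g : ℝ → ℝ)
    (hg : ∀ x : ℝ, g x = if x < z then ε else if x ≤ z + ε then ε - (x - z) else 0) :
    (∀ h : ℝ → ℝ, MonotoneOn h (Set.Icc 0 1) →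
      ε / 3 ≤ ∫ x in Set.Icc (0 : ℝ) 1, |g x - h x|) ∧
    ε / 3 ≤ sInf {d : ℝ | ∃ h : ℝ → ℝ, MonotoneOn h (Set.Icc 0 1) ∧
      IntegrableOn h (Set.Icc 0 1) ∧ d = ∫ x in Set.Icc (0 : ℝ) 1, |g x - h x|} := by
  have hg_left : ∀ x ≤ 1 / 3, g x = ε := by
    intro x hx
    rw [hg]
    split_ifs <;> linarith
  have hg_right : ∀ x, 2 / 3 ≤ x → g x = 0 := by
    intro x hx
    rw [hg]
    split_ifs <;> linarith
  have hg_anti : Antitone g := by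
    intro x y hxy
    rw [hg, hg]
    split_ifs <;> linarith
  have main : ∀ h : ℝ → ℝ, MonotoneOn h (Set.Icc 0 1) →
      ε / 3 ≤ ∫ x in Set.Icc (0 : ℝ) 1, |g x - h x| := by
    intro h hh
    have hint : IntegrableOn (fun x => |g x - h x|) (Set.Icc (0 : ℝ) 1) :=
      ((hg_anti.antitoneOn _).integrableOn_isCompact isCompact_Icc |>.sub
        (hh.integrableOn_isCompact isCompact_Icc)).abs
    have hsub_left : Set.Icc (0 : ℝ) (1 / 3) ⊆ Set.Icc 0 1 :=
      Set.Icc_subset_Icc le_rfl (by norm_num)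
    have hsub_right : Set.Icc (2 / 3 : ℝ) 1 ⊆ Set.Icc 0 1 :=
      Set.Icc_subset_Icc (by norm_num) le_rfl
    have hmid : (1 / 2 : ℝ) ∈ Set.Icc (0 : ℝ) 1 := by constructor <;> norm_num
    have hleft : (ε - h (1 / 2)) / 3 ≤ ∫ x in Set.Icc (0 : ℝ) (1 / 3), |g x - h x| := by
      have key := setIntegral_ge_of_const_le_real (μ := volume) (c := ε - h (1 / 2))
        (f := fun x => |g x - h x|) (measurableSet_Icc (a := (0 : ℝ)) (b := 1 / 3))
        (by simp) (fun x hx => ?_) (hint.mono_set hsub_left)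
      · rw [Real.volume_real_Icc_of_le (by norm_num)] at key
        linarith
      · have := hh (hsub_left hx) hmid (hx.2.trans (by norm_num))
        rw [hg_left x hx.2]
        exact (by linarith : _ ≤ ε - h x).trans (le_abs_self _)
    have hright : h (1 / 2) / 3 ≤ ∫ x in Set.Icc (2 / 3 : ℝ) 1, |g x - h x| := by
      have key := setIntegral_ge_of_const_le_real (μ := volume) (c := h (1 / 2))
        (f := fun x => |g x - h x|) (measurableSet_Icc (a := (2 / 3 : ℝ)) (b := 1))
        (by simp) (fun x hx => ?_) (hint.mono_set hsub_right)
      · rw [Real.volume_real_Icc_of_le (by norm_num)] at key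
        linarith
      · have := hh hmid (hsub_right hx) (le_trans (by norm_num) hx.1)
        rw [hg_right x hx.1, zero_sub, abs_neg]
        exact this.trans (le_abs_self _)
    have hdisj : Disjoint (Set.Icc (0 : ℝ) (1 / 3)) (Set.Icc (2 / 3) 1) :=
      Set.disjoint_left.2 fun x hx hx' => by linarith [hx.2, hx'.1]
    have hunion := setIntegral_union hdisj measurableSet_Icc
      (hint.mono_set hsub_left) (hint.mono_set hsub_right)
    have hmono := setIntegral_mono_set hint (.of_forall fun x => abs_nonneg _)
      (Set.union_subset hsub_left hsub_right).eventuallyLE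
    linarith
  refine ⟨main, le_csInf ⟨_, fun _ => 0, monotoneOn_const, integrableOn_zero, rfl⟩ ?_⟩
  rintro d ⟨h, hh, -, rfl⟩
  exact main h hh
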